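/- arXiv:2409.03596 — 2 statements merged into one kernel-verified Lean document; each statement's English description precedes it below -/
import Mathlib

section
/- Let k, d, q be positive integers with k ≥ 2, q ≥ 2. Let u be a non-leaf vertex of T_{k,d} with children u_1, ..., u_k, and let A ⊆ L(T_{k,d}) satisfy Frac_A(u_i) ≥ 1/(4q) for every i ∈ {1,...,k}. Suppose the bijections f_{u_1}, ..., f_{u_k}, where f_{u_i} : L(T^{u_i}) → {1,...,Leaves(u_i)}, are chosen independently and uniformly at random. Then the probability that u does NOT form a collision with respect to (A, (f_{u_i})_i) is at most exp(−Leaves(u)/(k·(4q)^k)). -/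
open MeasureTheory

/-- The uniform probability measure on a finite type (with the `⊤` σ-algebra). -/
noncomputable def uniformMeasure (α : Type*) [Fintype α] : @Measure α ⊤ :=
  (Fintype.card α : ENNReal)⁻¹ • @Measure.count α ⊤

/-- Leaves of the full `k`-ary tree `T_{k,d}` are modelled as words `Fin d → Fin k`; a vertex of
depth `h` is modelled as a prefix `p : Fin h → Fin k`. `frac k d A h hhd p` is
`Frac_A(v) = |A ∩ L(T^v)| / Leaves(v)` for the vertex `v` given by the prefix `p`. -/
noncomputable def frac (k d : ℕ) (A : Finset (Fin d → Fin k)) (h : ℕ) (hhd : h ≤ d)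
    (p : Fin h → Fin k) : ℝ :=
  ((A.filter fun w => ∀ i : Fin h, w (Fin.castLE hhd i) = p i).card : ℝ) / (k ^ (d - h) : ℝ)

/-- The leaf set `L(T^{u_c})` of the `c`-th child `u_c` of the vertex `u` of depth `h` given by
the prefix `p`: all words extending the prefix `Fin.snoc p c`. It has `k ^ (d - h - 1)`
elements. -/
def childLeaves (k d : ℕ) (h : ℕ) (hhd : h < d) (p : Fin h → Fin k) (c : Fin k) :
    Finset (Fin d → Fin k) :=
  Finset.univ.filter fun w => ∀ i : Fin (h + 1), w (Fin.castLE hhd i) = (Fin.snoc p c : Fin (h + 1) → Fin k) i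

open Finset in
/-- For a random bijection `f : α ≃ β` weighted by `1 - s` for each element of `R` in `f(S)`, an
element `x ∉ R` is at least as likely to lie in `f(S)` as any other element `y`. -/
theorem sum_equiv_prod_mul_indicator_le {α β : Type*} [Fintype α] [Fintype β] [DecidableEq α]
    [DecidableEq β] (S : Finset α) {s : ℝ} (hs0 : 0 ≤ s) (hs1 : s ≤ 1) {R : Finset β} {x : β}
    (hx : x ∉ R) (y : β) :
    ∑ f : α ≃ β, (∏ z ∈ R, (1 - s * if f.symm z ∈ S then 1 else 0)) *
        (if f.symm y ∈ S then 1 else 0) ≤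
      ∑ f : α ≃ β, (∏ z ∈ R, (1 - s * if f.symm z ∈ S then 1 else 0)) *
        (if f.symm x ∈ S then 1 else 0) := by
  have hswap : Function.Bijective fun f : α ≃ β => f.trans (Equiv.swap x y) :=
    Function.Involutive.bijective fun f => by ext a; simp
  rw [← hswap.sum_comp]
  refine sum_le_sum fun f _ => ?_
  have hymem : (f.trans (Equiv.swap x y)).symm y ∈ S ↔ f.symm x ∈ S := by simp
  by_cases hfx : f.symm x ∈ S
  · simp only [if_pos hfx, if_pos (hymem.2 hfx), mul_one]
    refine prod_le_prod (fun z _ => ?_) fun z hz => ?_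
    · split_ifs <;> linarith
    · have hmono : f.symm z ∈ S → (f.trans (Equiv.swap x y)).symm z ∈ S := by
        have hzx : z ≠ x := fun e => hx (e ▸ hz)
        by_cases hzy : z = y
        · exact fun _ => hzy ▸ hymem.2 hfx
        · simp [Equiv.swap_apply_of_ne_of_ne hzx hzy]
      by_cases hz' : f.symm z ∈ S
      · rw [if_pos hz', if_pos (hmono hz')]
      · rw [if_neg hz']
        split_ifs <;> linarith
  · rw [if_neg hfx, if_neg (hymem.not.2 hfx), mul_zero, mul_zero]

open Finset in
/-- The generating function of the size of the intersection of `R` with the image of `S` under a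
uniformly random bijection is at most that of the corresponding binomial distribution. -/
theorem sum_equiv_prod_le {α β : Type*} [Fintype α] [Fintype β] [DecidableEq α]
    [DecidableEq β] (S : Finset α) {s δ : ℝ} (hs0 : 0 ≤ s) (hs1 : s ≤ 1) (hδ1 : δ ≤ 1)
    (hS : δ * Fintype.card β ≤ #S) (R : Finset β) :
    ∑ f : α ≃ β, ∏ z ∈ R, (1 - s * if f.symm z ∈ S then 1 else 0) ≤
      Fintype.card (α ≃ β) * (1 - s * δ) ^ #R := by
  induction R using Finset.induction_on with
  | empty => simp
  | insert x R hx ih =>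
    set W : (α ≃ β) → ℝ := fun f => ∏ z ∈ R, (1 - s * if f.symm z ∈ S then 1 else 0) with hW
    have hW0 (f) : 0 ≤ W f := prod_nonneg fun z _ => by split_ifs <;> linarith
    have hcount (f : α ≃ β) : ∑ y, (if f.symm y ∈ S then (1 : ℝ) else 0) = #S := by
      rw [f.symm.sum_comp fun a => if a ∈ S then (1 : ℝ) else 0]
      simp
    have hsum : #S * ∑ f, W f ≤
        Fintype.card β * ∑ f, W f * (if f.symm x ∈ S then 1 else 0) := by
      calc #S * ∑ f, W f = ∑ y, ∑ f, W f * (if f.symm y ∈ S then 1 else 0) := by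
            rw [sum_comm, mul_sum]
            exact sum_congr rfl fun f _ => by rw [← mul_sum, hcount, mul_comm]
        _ ≤ ∑ _y : β, ∑ f, W f * (if f.symm x ∈ S then 1 else 0) :=
            sum_le_sum fun y _ => sum_equiv_prod_mul_indicator_le S hs0 hs1 hx y
        _ = _ := by simp
    have hn : (0 : ℝ) < Fintype.card β := by exact_mod_cast Fintype.card_pos_iff.2 ⟨x⟩
    have hWsum : 0 ≤ ∑ f, W f := sum_nonneg fun f _ => hW0 f
    have hmass : δ * ∑ f, W f ≤ ∑ f, W f * (if f.symm x ∈ S then 1 else 0) := by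
      refine le_of_mul_le_mul_left ?_ hn
      nlinarith [mul_le_mul_of_nonneg_right hS hWsum]
    have hsδ : 0 ≤ 1 - s * δ := by nlinarith
    calc ∑ f : α ≃ β, ∏ z ∈ insert x R, (1 - s * if f.symm z ∈ S then 1 else 0)
        = ∑ f, W f - s * ∑ f, W f * (if f.symm x ∈ S then 1 else 0) := by
          rw [mul_sum, ← sum_sub_distrib]
          exact sum_congr rfl fun f _ => by rw [prod_insert hx]; ring
      _ ≤ (1 - s * δ) * ∑ f, W f := by nlinarith
      _ ≤ (1 - s * δ) * (Fintype.card (α ≃ β) * (1 - s * δ) ^ #R) :=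
          mul_le_mul_of_nonneg_left ih hsδ
      _ = _ := by rw [card_insert_of_notMem hx]; ring

open Finset in
/-- The generating function of the size of the common intersection of the images of sets `S c`
of density at least `δ` under independent uniformly random bijections. -/
theorem sum_pi_equiv_prod_le {β : Type*} [Fintype β] [DecidableEq β] {δ : ℝ} (hδ0 : 0 ≤ δ)
    (hδ1 : δ ≤ 1) {k : ℕ} (α : Fin k → Type*) [∀ c, Fintype (α c)] [∀ c, DecidableEq (α c)]
    (S : ∀ c, Finset (α c)) (hS : ∀ c, δ * Fintype.card β ≤ #(S c)) {s : ℝ} (hs0 : 0 ≤ s)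
    (hs1 : s ≤ 1) :
    ∑ f : ∀ c, α c ≃ β, ∏ x, (1 - s * if ∀ c, (f c).symm x ∈ S c then 1 else 0) ≤
      Fintype.card (∀ c, α c ≃ β) * (1 - s * δ ^ k) ^ Fintype.card β := by
  induction k generalizing s with
  | zero => simp
  | succ k ih =>
    have hfactor (e : α 0 ≃ β) (g : ∀ c : Fin k, α c.succ ≃ β) :
        ∏ x, (1 - s * if ∀ c, ((Fin.cons e g : ∀ c, α c ≃ β) c).symm x ∈ S c then 1 else 0) =
          ∏ x with ∀ c, (g c).symm x ∈ S c.succ,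
            (1 - s * if e.symm x ∈ S 0 then 1 else 0) := by
      rw [prod_filter]
      refine prod_congr rfl fun x _ => ?_
      simp only [Fin.forall_fin_succ, Fin.cons_zero, Fin.cons_succ]
      by_cases hg : ∀ c, (g c).symm x ∈ S c.succ <;> simp [hg]
    have hpow (g : ∀ c : Fin k, α c.succ ≃ β) :
        (1 - s * δ) ^ #{x | ∀ c, (g c).symm x ∈ S c.succ} =
          ∏ x, (1 - s * δ * if ∀ c, (g c).symm x ∈ S c.succ then 1 else 0) := by
      rw [← prod_const, prod_filter]
      exact prod_congr rfl fun x _ => by split_ifs <;> simp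
    have hcard : Fintype.card (∀ c, α c ≃ β) =
        Fintype.card (α 0 ≃ β) * Fintype.card (∀ c : Fin k, α c.succ ≃ β) := by
      rw [← Fintype.card_prod]
      exact Fintype.card_congr (Fin.consEquiv fun c => α c ≃ β).symm
    rw [← (Fin.consEquiv fun c => α c ≃ β).sum_comp, Fintype.sum_prod_type, sum_comm]
    calc _ ≤ ∑ g : ∀ c : Fin k, α c.succ ≃ β, Fintype.card (α 0 ≃ β) *
            ∏ x, (1 - s * δ * if ∀ c, (g c).symm x ∈ S c.succ then 1 else 0) := by
          refine sum_le_sum fun g _ => ?_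
          rw [← hpow]
          refine le_trans (le_of_eq ?_) (sum_equiv_prod_le (S 0) hs0 hs1 hδ1 (hS 0) _)
          exact sum_congr rfl fun e _ => hfactor e g
      _ ≤ Fintype.card (α 0 ≃ β) * (Fintype.card (∀ c : Fin k, α c.succ ≃ β) *
            (1 - s * δ * δ ^ k) ^ Fintype.card β) := by
          rw [← mul_sum]
          exact mul_le_mul_of_nonneg_left
            (ih _ _ (fun c => hS c.succ) (mul_nonneg hs0 hδ0) (mul_le_one₀ hs1 hδ0 hδ1))
            (Nat.cast_nonneg _)
      _ = _ := by rw [hcard]; push_cast; ring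

open Finset in
/-- Independent uniformly random bijections map sets `S c` of density at least `δ` to sets without
a common element with probability at most `exp (-n δ ^ k)`, in counting form. -/
theorem card_no_common_image_le {β : Type*} [Fintype β] [DecidableEq β] {δ : ℝ} (hδ0 : 0 ≤ δ)
    (hδ1 : δ ≤ 1) {k : ℕ} (α : Fin k → Type*) [∀ c, Fintype (α c)] [∀ c, DecidableEq (α c)]
    (S : ∀ c, Finset (α c)) (hS : ∀ c, δ * Fintype.card β ≤ #(S c)) :
    (#{f : ∀ c, α c ≃ β | ¬ ∃ x, ∀ c, (f c).symm x ∈ S c} : ℝ) ≤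
      Fintype.card (∀ c, α c ≃ β) * Real.exp (-(Fintype.card β * δ ^ k)) := by
  have hpow : (1 - δ ^ k) ^ Fintype.card β ≤ Real.exp (-(Fintype.card β * δ ^ k)) := by
    rw [← mul_neg, Real.exp_nat_mul]
    refine pow_le_pow_left₀ (sub_nonneg.2 (pow_le_one₀ hδ0 hδ1)) ?_ _
    linarith [Real.add_one_le_exp (-δ ^ k)]
  calc (#{f : ∀ c, α c ≃ β | ¬ ∃ x, ∀ c, (f c).symm x ∈ S c} : ℝ)
      = ∑ f : ∀ c, α c ≃ β, if ¬ ∃ x, ∀ c, (f c).symm x ∈ S c then (1 : ℝ) else 0 := by simp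
    _ ≤ ∑ f : ∀ c, α c ≃ β, ∏ x, (1 - 1 * if ∀ c, (f c).symm x ∈ S c then (1 : ℝ) else 0) := by
        refine sum_le_sum fun f _ => ?_
        by_cases hf : ∃ x, ∀ c, (f c).symm x ∈ S c
        · rw [if_neg (not_not.2 hf)]
          exact prod_nonneg fun x _ => by split_ifs <;> simp
        · rw [if_pos hf]
          refine le_of_eq (prod_eq_one fun x _ => ?_).symm
          rw [if_neg fun hx => hf ⟨x, hx⟩]
          simp
    _ ≤ Fintype.card (∀ c, α c ≃ β) * (1 - 1 * δ ^ k) ^ Fintype.card β :=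
        sum_pi_equiv_prod_le hδ0 hδ1 α S hS zero_le_one le_rfl
    _ ≤ _ := by
        rw [one_mul]
        exact mul_le_mul_of_nonneg_left hpow (Nat.cast_nonneg _)

/-- A counting bound for a set gives a bound for its uniform measure. -/
theorem uniformMeasure_le_ofReal {α : Type*} [Fintype α] (s : Finset α) {r : ℝ}
    (hs : (s.card : ℝ) ≤ Fintype.card α * r) :
    uniformMeasure α (s : Set α) ≤ ENNReal.ofReal r := by
  let _ : MeasurableSpace α := ⊤
  have hcount : uniformMeasure α (s : Set α) = (Fintype.card α : ENNReal)⁻¹ * s.card := by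
    simp [uniformMeasure]
  rw [hcount, mul_comm, ← div_eq_mul_inv]
  refine ENNReal.div_le_of_le_mul ?_
  rw [mul_comm, ← ENNReal.ofReal_natCast, ← ENNReal.ofReal_natCast,
    ← ENNReal.ofReal_mul (Nat.cast_nonneg _)]
  exact ENNReal.ofReal_le_ofReal hs

/-- Let `k, q ≥ 2` and let `u` be a non-leaf vertex of `T_{k,d}` (of depth `h < d`, given by the
prefix `p`) all of whose children `u_c` satisfy `Frac_A(u_c) ≥ 1/(4q)`. Choose, independently
and uniformly at random, bijections `f c : L(T^{u_c}) ≃ {1, …, Leaves(u_c)}` for the `k`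
children (where `Leaves(u_c) = k^{d-h-1} = Leaves(u)/k`). Then the probability that `u` does
NOT form a collision — i.e. that there is no common value `x` with `f c (a c) = x` for some
leaves `a c ∈ A ∩ L(T^{u_c})` — is at most `exp (-Leaves(u) / (k (4q)^k))`. -/
theorem prob_no_collision_at_vertex {k d q : ℕ} (hk : 2 ≤ k) (hq : 2 ≤ q)
    {h : ℕ} (hhd : h < d) (p : Fin h → Fin k)
    (A : Finset (Fin d → Fin k))
    (hfrac : ∀ c : Fin k, (1 : ℝ) / (4 * q) ≤ frac k d A (h + 1) hhd (Fin.snoc p c)) :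
    uniformMeasure (∀ c : Fin k, {w // w ∈ childLeaves k d h hhd p c} ≃ Fin (k ^ (d - h - 1)))
        {f | ¬ ∃ x : Fin (k ^ (d - h - 1)), ∀ c : Fin k,
          ∃ a, ∃ ha : a ∈ childLeaves k d h hhd p c, a ∈ A ∧ f c ⟨a, ha⟩ = x} ≤
      ENNReal.ofReal (Real.exp (-((k : ℝ) ^ (d - h) / ((k : ℝ) * (4 * (q : ℝ)) ^ k)))) := by
  set n := k ^ (d - h - 1) with hn
  have hq0 : (2 : ℝ) ≤ q := by exact_mod_cast hq
  have hk0 : (0 : ℝ) < k := by exact_mod_cast (by omega : 0 < k)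
  have hnpos : (0 : ℝ) < (k : ℝ) ^ (d - (h + 1)) := by positivity
  let S : ∀ c : Fin k, Finset {w // w ∈ childLeaves k d h hhd p c} := fun c =>
    Finset.univ.filter fun w => w.1 ∈ A
  have hS (c : Fin k) : (1 : ℝ) / (4 * q) * Fintype.card (Fin n) ≤ (S c).card := by
    have hle := hfrac c
    rw [frac, le_div_iff₀ hnpos] at hle
    have hcard : (S c).card = (A.filter fun w => ∀ i : Fin (h + 1),
        w (Fin.castLE hhd i) = (Fin.snoc p c : Fin (h + 1) → Fin k) i).card := by
      rw [← Finset.card_map (Function.Embedding.subtype _)]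
      congr 1
      ext w
      refine Finset.mem_map.trans ⟨?_, fun hw => ?_⟩
      · rintro ⟨v, hv, rfl⟩
        exact Finset.mem_filter.2 ⟨(Finset.mem_filter.1 hv).2, (Finset.mem_filter.1 v.2).2⟩
      · obtain ⟨hwA, hwp⟩ := Finset.mem_filter.1 hw
        exact ⟨⟨w, Finset.mem_filter.2 ⟨Finset.mem_univ _, hwp⟩⟩,
          Finset.mem_filter.2 ⟨Finset.mem_univ _, hwA⟩, rfl⟩
    rw [hcard, Fintype.card_fin, hn, Nat.sub_sub]
    push_cast
    exact hle
  have hbound := card_no_common_image_le (β := Fin n) (by positivity)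
    (by rw [div_le_one (by positivity)]; linarith) _ S hS
  have hexp : (Fintype.card (Fin n) : ℝ) * (1 / (4 * q)) ^ k =
      (k : ℝ) ^ (d - h) / ((k : ℝ) * (4 * (q : ℝ)) ^ k) := by
    have hdh : d - h = d - h - 1 + 1 := by omega
    rw [Fintype.card_fin, hn, hdh, pow_succ, Nat.add_sub_cancel, one_div, inv_pow]
    push_cast
    field_simp
  rw [hexp] at hbound
  convert uniformMeasure_le_ofReal _ hbound using 2
  ext f
  simp only [Set.mem_ofPred_eq, Finset.coe_filter, Finset.mem_univ, true_and]
  refine not_congr (exists_congr fun x => forall_congr' fun c => ?_)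
  constructor
  · rintro ⟨a, ha, haA, rfl⟩
    simpa [S] using haA
  · intro hx
    exact ⟨_, ((f c).symm x).2, by simpa [S] using hx, by simp⟩
end

section
/- Let k, d, q be positive integers with k ≥ 2, q ≥ 2, and d ≥ k·(4q)^{4k·log(k)} (logarithm base 2). Then there exists a scheme β for T_{k,d} such that for every q-subset A ⊆ L(T_{k,d}) there is a vertex of T_{k,d} that forms a collision with respect to (A, β). -/
/-- A vertex of the full `k`-ary tree `T_{k,d}`: a depth `h ∈ {0, …, d}` together with the
word of length `h` describing the path from the root. Leaves of `T_{k,d}` are modelled as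
words `Fin d → Fin k`. -/
abbrev Vtx (k d : ℕ) := Σ h : Fin (d + 1), (Fin (h : ℕ) → Fin k)

/-- The leaf set `L(T^v)` of the subtree rooted at `v`: all words extending the prefix `v.2`.
It has `Leaves(v) = k ^ (d - depth v)` elements. -/
def subLeaves {k d : ℕ} (v : Vtx k d) : Finset (Fin d → Fin k) :=
  Finset.univ.filter fun w => ∀ i : Fin (v.1 : ℕ), w (Fin.castLE v.1.is_le i) = v.2 i

/-- A scheme for `T_{k,d}`: a bijection `f_v : L(T^v) ≃ {1, …, Leaves(v)}` for every vertex
`v` of `T_{k,d}`. -/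
abbrev Scheme (k d : ℕ) :=
  ∀ v : Vtx k d, {w // w ∈ subLeaves v} ≃ Fin (k ^ (d - (v.1 : ℕ)))

/-- The `c`-th child of a non-leaf vertex `v` of `T_{k,d}`. -/
abbrev child {k d : ℕ} (v : Vtx k d) (hv : (v.1 : ℕ) < d) (c : Fin k) : Vtx k d :=
  ⟨⟨(v.1 : ℕ) + 1, by omega⟩, Fin.snoc v.2 c⟩

/-- The vertex `u` forms a collision with respect to `(A, β)` if `A` contains leaves
`a_1, …, a_k`, one in the subtree of each of the `k` (distinct) children `u_1, …, u_k` of `u`,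
with `f_{u_1}(a_1) = ⋯ = f_{u_k}(a_k)`. -/
def Collision {k d : ℕ} (A : Finset (Fin d → Fin k)) (β : Scheme k d) (u : Vtx k d) : Prop :=
  ∃ (hu : (u.1 : ℕ) < d) (x : Fin (k ^ (d - ((u.1 : ℕ) + 1)))),
    ∀ c : Fin k, ∃ a, ∃ ha : a ∈ subLeaves (child u hu c), a ∈ A ∧
      β (child u hu c) ⟨a, ha⟩ = x

open Finset Equiv in
/-- The tuples of permutations for which no point is mapped into `B c` by every coordinate `c`. -/
def avoidingPerms {k n : ℕ} (B : Fin k → Finset (Fin n)) : Finset (Fin k → Perm (Fin n)) :=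
  univ.filter fun σ => ∀ x, ∃ c, σ c x ∉ B c

open Finset Equiv in
/-- Revealing the values of the permutations at one point after another, each of the first `m`
points is mapped into all the sets `B c` with conditional probability at least `δ`. -/
theorem card_avoidingPerms_le {k t : ℕ} (hk : 0 < k) (ht : 0 < t) {δ : ℝ} (hδ0 : 0 ≤ δ)
    (hδ1 : δ ≤ 1) (m : ℕ) : ∀ {n : ℕ} (B : Fin k → Finset (Fin n)),
      δ * (n : ℝ) ^ k ≤ (t : ℝ) ^ k → (∀ c, m + t ≤ (B c).card + 1) →
      ((avoidingPerms B).card : ℝ) ≤ (1 - δ) ^ m * (n.factorial : ℝ) ^ k := by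
  induction m with
  | zero =>
    intro n B _ _
    have h := card_le_univ (avoidingPerms B)
    rw [Fintype.card_pi_const, Fintype.card_perm, Fintype.card_fin] at h
    simpa using (by exact_mod_cast h : ((avoidingPerms B).card : ℝ) ≤ (n.factorial : ℝ) ^ k)
  | succ m ih =>
    intro n B hn hB
    obtain _ | n := n
    · have h₁ := hB ⟨0, hk⟩
      have h₂ := card_le_univ (B ⟨0, hk⟩)
      rw [Fintype.card_fin] at h₂
      omega
    let B' : (Fin k → Fin (n + 1)) → Fin k → Finset (Fin n) := fun p c =>
      univ.filter fun y => swap 0 (p c) y.succ ∈ B c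
    have hB' : ∀ p c, (B c).card ≤ (B' p c).card + 1 := by
      intro p c
      have hsub : B c ⊆ insert (p c) ((B' p c).image fun y => swap 0 (p c) y.succ) := by
        intro z hz
        rw [mem_insert]
        by_cases hzp : z = p c
        · exact Or.inl hzp
        right
        have h0 : swap 0 (p c) z ≠ 0 := by
          intro h
          apply hzp
          have := congrArg (swap 0 (p c)) h
          simpa using this
        obtain ⟨y, hy⟩ := Fin.exists_succ_eq.2 h0
        have hy' : swap 0 (p c) y.succ = z := by rw [hy]; simp
        exact mem_image.2 ⟨y, by simp [B', hy', hz], hy'⟩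
      exact (card_le_card hsub).trans ((card_insert_le _ _).trans
        (Nat.add_le_add_right card_image_le 1))
    let P : Finset (Fin k → Fin (n + 1)) := (Fintype.piFinset B)ᶜ
    have hcard : (avoidingPerms B).card ≤ ∑ p ∈ P, (avoidingPerms (B' p)).card := by
      rw [← card_sigma]
      apply card_le_card_of_injOn
        (fun σ => ⟨fun c => (Perm.decomposeFin (σ c)).1, fun c => (Perm.decomposeFin (σ c)).2⟩)
      · intro σ hσ
        have hσ' : ∀ x, ∃ c, σ c x ∉ B c := by simpa [avoidingPerms] using hσ
        have hzero : ∀ c, (Perm.decomposeFin (σ c)).1 = σ c 0 := fun c => by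
          conv_rhs => rw [← Perm.decomposeFin.symm_apply_apply (σ c)]
          exact (Perm.decomposeFin_symm_apply_zero _ _).symm
        have hsucc : ∀ c x, swap 0 (Perm.decomposeFin (σ c)).1
            ((Perm.decomposeFin (σ c)).2 x).succ = σ c x.succ := fun c x => by
          rw [← Perm.decomposeFin_symm_apply_succ, Prod.mk.eta, symm_apply_apply]
        refine mem_coe.2 (mem_sigma.2 ⟨by simpa [P, hzero] using hσ' 0, ?_⟩)
        simp only [avoidingPerms, mem_filter, mem_univ, true_and]
        intro x
        obtain ⟨c, hc⟩ := hσ' x.succ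
        refine ⟨c, fun h => hc ?_⟩
        rw [← hsucc]
        exact (mem_filter.1 h).2
      · intro σ _ τ _ h
        rw [Sigma.mk.injEq, heq_eq_eq] at h
        funext c
        exact Perm.decomposeFin.injective (Prod.ext (congrFun h.1 c) (congrFun h.2 c))
    have hδt : ∀ c, t ≤ (B c).card := fun c => by have := hB c; omega
    have hP : (P.card : ℝ) ≤ (1 - δ) * ((n + 1 : ℕ) : ℝ) ^ k := by
      have h1 : P.card + ∏ c, (B c).card = (n + 1) ^ k := by
        have := card_compl_add_card (Fintype.piFinset B)
        rwa [Fintype.card_piFinset, Fintype.card_pi_const, Fintype.card_fin] at this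
      have h2 : t ^ k ≤ ∏ c, (B c).card := by
        simpa using prod_le_prod' (s := univ) fun c _ => hδt c
      have h1' : (P.card : ℝ) + ((∏ c, (B c).card : ℕ) : ℝ) = ((n + 1 : ℕ) : ℝ) ^ k := by
        exact_mod_cast h1
      have h2' : (t : ℝ) ^ k ≤ ((∏ c, (B c).card : ℕ) : ℝ) := by exact_mod_cast h2
      linarith
    have hrec : ∀ p, ((avoidingPerms (B' p)).card : ℝ) ≤ (1 - δ) ^ m * (n.factorial : ℝ) ^ k := by
      intro p
      refine ih (B' p) (le_trans ?_ hn) fun c => ?_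
      · gcongr
        omega
      · have := hB c
        have := hB' p c
        omega
    calc ((avoidingPerms B).card : ℝ) ≤ ∑ p ∈ P, ((avoidingPerms (B' p)).card : ℝ) := by
          exact_mod_cast hcard
      _ ≤ P.card * ((1 - δ) ^ m * (n.factorial : ℝ) ^ k) := by
          simpa using sum_le_card_nsmul P _ _ fun p _ => hrec p
      _ ≤ (1 - δ) * ((n + 1 : ℕ) : ℝ) ^ k * ((1 - δ) ^ m * (n.factorial : ℝ) ^ k) := by
          have : 0 ≤ 1 - δ := by linarith
          gcongr
      _ = (1 - δ) ^ (m + 1) * ((n + 1).factorial : ℝ) ^ k := by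
          rw [Nat.factorial_succ, Nat.cast_mul, mul_pow]
          ring

open Finset Equiv in
/-- If every `B c` has density at least `1 / s`, then a random tuple of permutations avoids `B`
with probability exponentially small in `n`. -/
theorem card_avoidingPerms_le_exp {k n s : ℕ} (hk : 0 < k) (hn : 0 < n) (hs : 0 < s)
    (B : Fin k → Finset (Fin n)) (hB : ∀ c, (n : ℝ) / s ≤ (B c).card) :
    ((avoidingPerms B).card : ℝ) ≤
      Real.exp (-(n / (2 * s) ^ (k + 1))) * Fintype.card (Fin k → Perm (Fin n)) := by
  have hs' : (1 : ℝ) ≤ s := by exact_mod_cast hs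
  have hn' : (0 : ℝ) < n := by exact_mod_cast hn
  let m := ⌈(n : ℝ) / (2 * s)⌉₊
  have hm : (n : ℝ) / (2 * s) ≤ m := Nat.le_ceil _
  have hm' : (m : ℝ) < n / (2 * s) + 1 := Nat.ceil_lt_add_one (by positivity)
  have hm0 : 0 < m := Nat.ceil_pos.2 (by positivity)
  have hmB : ∀ c, m + m ≤ (B c).card + 1 := fun c => by
    have h : (n : ℝ) / (2 * s) + n / (2 * s) = n / s := by field_simp; norm_num
    have : ((m + m : ℕ) : ℝ) < ((B c).card + 2 : ℕ) := by
      push_cast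
      linarith [hB c]
    have := Nat.cast_lt.1 this
    omega
  have hδ1 : (1 / (2 * s : ℝ)) ^ k ≤ 1 := pow_le_one₀ (by positivity)
    ((div_le_one (by positivity)).2 (by linarith))
  refine (card_avoidingPerms_le hk hm0 (δ := (1 / (2 * s : ℝ)) ^ k) (by positivity) hδ1 m B ?_
    hmB).trans ?_
  · rw [← mul_pow]
    gcongr
    rwa [one_div_mul_eq_div]
  · rw [Fintype.card_pi_const, Fintype.card_perm, Fintype.card_fin, Nat.cast_pow]
    gcongr
    calc (1 - (1 / (2 * s : ℝ)) ^ k) ^ m ≤ Real.exp (-(1 / (2 * s : ℝ)) ^ k) ^ m := by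
          refine pow_le_pow_left₀ (by linarith) ?_ m
          linarith [Real.add_one_le_exp (-(1 / (2 * s : ℝ)) ^ k)]
      _ = Real.exp (-((1 / (2 * s : ℝ)) ^ k * m)) := by
          rw [← Real.exp_nat_mul]
          congr 1
          ring
      _ ≤ _ := by
          gcongr
          calc (n : ℝ) / (2 * s) ^ (k + 1) = (1 / (2 * s : ℝ)) ^ k * (n / (2 * s)) := by
                rw [one_div_pow, pow_succ]
                field_simp
            _ ≤ _ := by gcongr

/-- The second moment of a martingale on the `k`-ary tree with values in `[0, 1]` bounds the
number of levels at which it often changes much, so on average many vertices have only children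
of value at least `1 / (4 q)`. -/
theorem le_sum_card_children_large {k d q : ℕ} (hk : 0 < k) (hq : 0 < q)
    (α : (h : ℕ) → (Fin h → Fin k) → ℝ) (h0 : ∀ h u, h ≤ d → 0 ≤ α h u)
    (h1 : ∀ h u, h ≤ d → α h u ≤ 1)
    (hα : ∀ h u, h < d → ∑ c, α (h + 1) (Fin.snoc u c) = k * α h u)
    (hroot : ∀ u, 1 / (q : ℝ) ≤ α 0 u) :
    (d : ℝ) / (2 * q) - 16 * k * q ^ 2 ≤ ∑ h ∈ Finset.range d,
      ((Finset.univ.filter fun u : Fin h → Fin k =>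
        ∀ c, 1 / (4 * q : ℝ) ≤ α (h + 1) (Fin.snoc u c)).card : ℝ) / (k : ℝ) ^ h := by
  have hk' : (0 : ℝ) < k := by exact_mod_cast hk
  have hq' : (0 : ℝ) < q := by exact_mod_cast hq
  have hsum : ∀ (h : ℕ) (f : (Fin (h + 1) → Fin k) → ℝ),
      ∑ v, f v = ∑ u : Fin h → Fin k, ∑ c, f (Fin.snoc u c) := by
    intro h f
    rw [← (Fin.snocEquiv fun _ => Fin k).sum_comp, Fintype.sum_prod_type, Finset.sum_comm]
    rfl
  let S : ℕ → ℝ := fun h => (∑ u, α h u) / k ^ h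
  let Q : ℕ → ℝ := fun h => (∑ u, α h u ^ 2) / k ^ h
  have hS : ∀ h ≤ d, 1 / (q : ℝ) ≤ S h := by
    intro h
    induction h with
    | zero => intro _; simpa [S] using hroot _
    | succ h ih =>
      intro hd
      refine (ih (by omega)).trans_eq ?_
      simp only [S, hsum, hα h _ (by omega : h < d), ← Finset.mul_sum, pow_succ]
      field_simp
  have hQ : Q d ≤ 1 := by
    rw [div_le_one (by positivity)]
    calc ∑ u, α d u ^ 2 ≤ ∑ u : Fin d → Fin k, (1 : ℝ) := Finset.sum_le_sum fun u _ =>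
          pow_le_one₀ (h0 d u le_rfl) (h1 d u le_rfl)
      _ = (k : ℝ) ^ d := by simp
  have hQ0 : 0 ≤ Q 0 := by positivity
  have hvertex : ∀ h < d, ∀ u : Fin h → Fin k,
      α h u - 1 / (2 * q) - 16 * q ^ 2 * (∑ c, α (h + 1) (Fin.snoc u c) ^ 2 - k * α h u ^ 2) ≤
        if ∀ c, 1 / (4 * q : ℝ) ≤ α (h + 1) (Fin.snoc u c) then 1 else 0 := by
    intro h hd u
    have hvar : ∑ c, α (h + 1) (Fin.snoc u c) ^ 2 - k * α h u ^ 2 =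
        ∑ c, (α (h + 1) (Fin.snoc u c) - α h u) ^ 2 := by
      simp only [sub_sq, Finset.sum_add_distrib, Finset.sum_sub_distrib, ← Finset.sum_mul,
        ← Finset.mul_sum, hα h u hd]
      simp
      ring
    have hα1 := h1 h u hd.le
    have hpos : 0 ≤ ∑ c, (α (h + 1) (Fin.snoc u c) - α h u) ^ 2 := by positivity
    have hpos' : 0 ≤ 16 * (q : ℝ) ^ 2 * ∑ c, (α (h + 1) (Fin.snoc u c) - α h u) ^ 2 := by
      positivity
    have hq2 : 0 < 1 / (2 * q : ℝ) := by positivity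
    rw [hvar]
    split_ifs with hgood
    · linarith
    · by_cases hu : α h u ≤ 1 / (2 * q)
      · linarith
      push Not at hgood hu
      obtain ⟨c, hc⟩ := hgood
      have hhalf : 1 / (2 * q : ℝ) = 1 / (4 * q) + 1 / (4 * q) := by field_simp; norm_num
      have hsq : (1 / (4 * q : ℝ)) ^ 2 ≤ (α (h + 1) (Fin.snoc u c) - α h u) ^ 2 := by
        rw [sub_sq_comm]
        apply pow_le_pow_left₀ (by positivity)
        linarith
      have hle := Finset.single_le_sum (f := fun c => (α (h + 1) (Fin.snoc u c) - α h u) ^ 2)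
        (fun c _ => sq_nonneg _) (Finset.mem_univ c)
      have : (1 : ℝ) ≤ 16 * q ^ 2 * ∑ c, (α (h + 1) (Fin.snoc u c) - α h u) ^ 2 :=
        calc (1 : ℝ) = 16 * q ^ 2 * (1 / (4 * q)) ^ 2 := by field_simp; norm_num
          _ ≤ _ := by
            gcongr
            exact hsq.trans hle
      linarith
  have hlevel : ∀ h ∈ Finset.range d, 1 / (2 * q : ℝ) - 16 * k * q ^ 2 * (Q (h + 1) - Q h) ≤
      ((Finset.univ.filter fun u : Fin h → Fin k =>
        ∀ c, 1 / (4 * q : ℝ) ≤ α (h + 1) (Fin.snoc u c)).card : ℝ) / (k : ℝ) ^ h := by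
    intro h hh
    have hd := Finset.mem_range.1 hh
    have hle := Finset.sum_le_sum fun u (_ : u ∈ Finset.univ) => hvertex h hd u
    rw [Finset.sum_boole, Finset.sum_sub_distrib, Finset.sum_sub_distrib, ← Finset.mul_sum,
      Finset.sum_sub_distrib, ← Finset.mul_sum, ← hsum h fun v => α (h + 1) v ^ 2] at hle
    refine le_trans ?_ (div_le_div_of_nonneg_right hle (by positivity))
    have hSh := hS h hd.le
    have hhalf : 1 / (q : ℝ) = 1 / (2 * q) + 1 / (2 * q) := by field_simp; norm_num
    have heq : (∑ u, α h u - ∑ _u : Fin h → Fin k, 1 / (2 * q : ℝ) -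
        16 * q ^ 2 * (∑ v, α (h + 1) v ^ 2 - k * ∑ u, α h u ^ 2)) / (k : ℝ) ^ h =
        S h - 1 / (2 * q) - 16 * k * q ^ 2 * (Q (h + 1) - Q h) := by
      simp only [S, Q, Finset.sum_const, Finset.card_univ, Fintype.card_pi_const,
        Fintype.card_fin, nsmul_eq_mul, Nat.cast_pow, pow_succ (k : ℝ) h]
      field_simp
    rw [heq]
    linarith
  refine le_trans ?_ (Finset.sum_le_sum hlevel)
  rw [Finset.sum_sub_distrib, ← Finset.mul_sum, Finset.sum_range_sub]
  simp only [Finset.sum_const, Finset.card_range, nsmul_eq_mul]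
  have : 16 * k * (q : ℝ) ^ 2 * (Q d - Q 0) ≤ 16 * k * q ^ 2 * 1 := by
    gcongr
    linarith
  rw [mul_one_div]
  linarith

/-- A union bound over `F` in a product of finite probability spaces. -/
theorem exists_pi_forall_exists_notMem {V ι : Type*} [Fintype V] [DecidableEq V] {Ω : V → Type*}
    [∀ v, Fintype (Ω v)] [∀ v, Nonempty (Ω v)] (F : Finset ι) (bad : ι → ∀ v, Finset (Ω v))
    (p : ι → V → ℝ) (hbad : ∀ i ∈ F, ∀ v, ((bad i v).card : ℝ) ≤ p i v * Fintype.card (Ω v))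
    (hp : ∑ i ∈ F, ∏ v, p i v < 1) : ∃ ω : ∀ v, Ω v, ∀ i ∈ F, ∃ v, ω v ∉ bad i v := by
  classical
  by_contra! hcon
  have hcover : (Finset.univ : Finset (∀ v, Ω v)) ⊆ F.biUnion fun i => Fintype.piFinset (bad i) := by
    intro ω _
    obtain ⟨i, hi, h⟩ := hcon ω
    exact Finset.mem_biUnion.2 ⟨i, hi, Fintype.mem_piFinset.2 h⟩
  have hcard := (Finset.card_le_card hcover).trans Finset.card_biUnion_le
  rw [Finset.card_univ, Fintype.card_pi] at hcard
  have hcard' : ∏ v, (Fintype.card (Ω v) : ℝ) ≤ ∑ i ∈ F, ∏ v, ((bad i v).card : ℝ) := by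
    simp only [Fintype.card_piFinset] at hcard
    exact_mod_cast hcard
  have hpos : 0 < ∏ v, (Fintype.card (Ω v) : ℝ) :=
    Finset.prod_pos fun v _ => by exact_mod_cast Fintype.card_pos
  have hle : ∑ i ∈ F, ∏ v, ((bad i v).card : ℝ) ≤
      (∑ i ∈ F, ∏ v, p i v) * ∏ v, (Fintype.card (Ω v) : ℝ) := by
    rw [Finset.sum_mul]
    refine Finset.sum_le_sum fun i hi => ?_
    rw [← Finset.prod_mul_distrib]
    exact Finset.prod_le_prod (fun _ _ => by positivity) fun v _ => hbad i hi v
  nlinarith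

/-- The number of leaves in `A` extending the word `u` of length `h`. -/
def extensionCount {k d : ℕ} (A : Finset (Fin d → Fin k)) (h : ℕ) (u : Fin h → Fin k) : ℕ :=
  (A.filter fun w => ∀ (i : Fin h) (hi : (i : ℕ) < d), w ⟨i, hi⟩ = u i).card

theorem sum_extensionCount_snoc {k d : ℕ} (A : Finset (Fin d → Fin k)) {h : ℕ} (hd : h < d)
    (u : Fin h → Fin k) : ∑ c, extensionCount A (h + 1) (Fin.snoc u c) = extensionCount A h u := by
  rw [extensionCount, Finset.card_eq_sum_card_fiberwise (f := fun w => w ⟨h, hd⟩) (t := Finset.univ)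
    (fun _ _ => Finset.mem_coe.2 (Finset.mem_univ _))]
  refine Finset.sum_congr rfl fun c _ => ?_
  rw [extensionCount, Finset.filter_filter]
  congr 1
  refine Finset.filter_congr fun w _ => ?_
  rw [Fin.forall_fin_succ']
  simp [hd]

theorem extensionCount_univ {k d h : ℕ} (hd : h ≤ d) (u : Fin h → Fin k) :
    extensionCount (Finset.univ : Finset (Fin d → Fin k)) h u = k ^ (d - h) := by
  induction hd using Nat.decreasingInduction with
  | self =>
    rw [Nat.sub_self, pow_zero, extensionCount, Finset.card_eq_one]
    refine ⟨u, ?_⟩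
    ext w
    simp [funext_iff]
  | of_succ h hlt ih =>
    rw [← sum_extensionCount_snoc _ hlt]
    simp only [ih, Finset.sum_const, Finset.card_univ, Fintype.card_fin, smul_eq_mul]
    rw [← pow_succ']
    congr 1
    omega

theorem extensionCount_le {k d h : ℕ} (A : Finset (Fin d → Fin k)) (hd : h ≤ d) (u : Fin h → Fin k) :
    extensionCount A h u ≤ k ^ (d - h) := by
  rw [← extensionCount_univ hd u]
  exact Finset.card_le_card (Finset.filter_subset_filter _ (Finset.subset_univ _))

theorem card_filter_subLeaves {k d : ℕ} (A : Finset (Fin d → Fin k)) (v : Vtx k d) :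
    ((subLeaves v).filter (· ∈ A)).card = extensionCount A v.1 v.2 := by
  rw [extensionCount, subLeaves, Finset.filter_filter]
  congr 1
  ext w
  have : ∀ i : Fin (v.1 : ℕ), (i : ℕ) < d := fun i => i.2.trans_le v.1.is_le
  simp [this, and_comm, Fin.castLE]

theorem nonempty_subLeaves_equiv {k d : ℕ} (v : Vtx k d) :
    Nonempty ({w // w ∈ subLeaves v} ≃ Fin (k ^ (d - (v.1 : ℕ)))) := by
  refine ⟨Fintype.equivFinOfCardEq ?_⟩
  rw [Fintype.card_coe, ← extensionCount_univ v.1.is_le v.2, ← card_filter_subLeaves]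
  simp

theorem exists_forall_apply_eq_of_injective {I V : Type*} {g : I → V}
    (hg : Function.Injective g) {F : V → Type*} [∀ v, Nonempty (F v)] (ω : ∀ i, F (g i)) :
    ∃ β : ∀ v, F v, ∀ i, β (g i) = ω i := by
  have h : ∀ v, ∃ b : F v, ∀ i (e : g i = v), e ▸ ω i = b := by
    intro v
    by_cases hv : ∃ i, g i = v
    · obtain ⟨i, rfl⟩ := hv
      refine ⟨ω i, fun j e => ?_⟩
      obtain rfl := hg e
      rfl
    · exact ⟨Classical.arbitrary _, fun i e => (hv ⟨i, e⟩).elim⟩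
  choose β hβ using h
  exact ⟨β, fun i => (hβ (g i) i rfl).symm⟩

theorem four_mul_pow_le_of_rpow_le {k d q : ℕ} (hk : 2 ≤ k) (hq : 2 ≤ q)
    (hd : (k : ℝ) * (4 * (q : ℝ)) ^ (4 * (k : ℝ) * Real.logb 2 k) ≤ (d : ℝ)) :
    (k : ℝ) * (4 * q) ^ (4 * k) ≤ d := by
  have hk' : (2 : ℝ) ≤ k := by exact_mod_cast hk
  have hq' : (2 : ℝ) ≤ q := by exact_mod_cast hq
  refine le_trans ?_ hd
  have hlog : 1 ≤ Real.logb 2 k := by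
    rw [Real.le_logb_iff_rpow_le one_lt_two (by linarith), Real.rpow_one]
    exact hk'
  rw [← Real.rpow_natCast]
  gcongr
  · linarith
  · push_cast
    nlinarith

/-- Let `k, q ≥ 2` and `d ≥ k (4q)^{4 k log₂ k}`. Then there exists a scheme `β` for `T_{k,d}`
such that every `q`-subset `A ⊆ L(T_{k,d})` (i.e. `|A| ≥ k^d / q`) has a collision with
respect to `β` at some vertex of `T_{k,d}`. -/
theorem exists_scheme_with_collisions {k d q : ℕ} (hk : 2 ≤ k) (hq : 2 ≤ q)
    (hd : (k : ℝ) * (4 * (q : ℝ)) ^ (4 * (k : ℝ) * Real.logb 2 k) ≤ (d : ℝ)) :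
    ∃ β : Scheme k d, ∀ A : Finset (Fin d → Fin k),
      (k ^ d : ℝ) / q ≤ (A.card : ℝ) → ∃ u : Vtx k d, Collision A β u := by
  classical
  have hdk := four_mul_pow_le_of_rpow_le hk hq hd
  have hk' : (2 : ℝ) ≤ k := by exact_mod_cast hk
  have hk0 : (0 : ℝ) < k := by linarith
  have hq' : (2 : ℝ) ≤ q := by exact_mod_cast hq
  have e : ∀ v : Vtx k d, {w // w ∈ subLeaves v} ≃ Fin (k ^ (d - (v.1 : ℕ))) :=
    fun v => (nonempty_subLeaves_equiv v).some
  let V := Σ h : Fin d, (Fin (h : ℕ) → Fin k)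
  let vtx : V → Vtx k d := fun v => ⟨v.1.castSucc, v.2⟩
  have hvtx : ∀ v : V, ((vtx v).1 : ℕ) < d := fun v => v.1.2
  let Ω : V → Type := fun v => Fin k → Equiv.Perm (Fin (k ^ (d - ((v.1 : ℕ) + 1))))
  let B : Finset (Fin d → Fin k) → ∀ v : V, Fin k → Finset (Fin (k ^ (d - ((v.1 : ℕ) + 1)))) :=
    fun A v c => Finset.univ.filter fun x => ((e (child (vtx v) (hvtx v) c)).symm x).1 ∈ A
  have hB : ∀ A v c, (B A v c).card = extensionCount A (v.1 + 1) (Fin.snoc v.2 c) := by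
    intro A v c
    refine Eq.trans ?_ (card_filter_subLeaves A (child (vtx v) (hvtx v) c))
    refine Finset.card_bij (fun x _ => ((e (child (vtx v) (hvtx v) c)).symm x).1) ?_ ?_ ?_
    · intro x hx
      exact Finset.mem_filter.2 ⟨Subtype.prop _, (Finset.mem_filter.1 hx).2⟩
    · intro x _ y _ hxy
      exact (e (child (vtx v) (hvtx v) c)).symm.injective (Subtype.ext hxy)
    · intro a ha
      obtain ⟨ha1, ha2⟩ := Finset.mem_filter.1 ha
      exact ⟨e _ ⟨a, ha1⟩, by simpa [B] using ha2, by simp⟩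
  let α : Finset (Fin d → Fin k) → (h : ℕ) → (Fin h → Fin k) → ℝ :=
    fun A h u => extensionCount A h u / (k : ℝ) ^ (d - h)
  let good : Finset (Fin d → Fin k) → V → Prop := fun A v =>
    ∀ c, 1 / (4 * q : ℝ) ≤ α A (v.1 + 1) (Fin.snoc v.2 c)
  let cost : Finset (Fin d → Fin k) → V → ℝ := fun A v =>
    if good A v then (k : ℝ) ^ (d - ((v.1 : ℕ) + 1)) / (2 * (4 * q)) ^ (k + 1) else 0
  let F : Finset (Finset (Fin d → Fin k)) :=
    Finset.univ.filter fun A => (k ^ d : ℝ) / q ≤ (A.card : ℝ)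
  have hbad : ∀ A ∈ F, ∀ v, ((avoidingPerms (B A v)).card : ℝ) ≤
      Real.exp (-cost A v) * Fintype.card (Ω v) := by
    intro A _ v
    by_cases hg : good A v
    · have h := card_avoidingPerms_le_exp (s := 4 * q) (by omega : 0 < k)
        (by positivity : 0 < k ^ (d - ((v.1 : ℕ) + 1))) (by omega) (B A v) fun c => by
          have := hg c
          rw [le_div_iff₀ (by positivity), one_div_mul_eq_div] at this
          rw [hB]
          push_cast
          exact this
      simpa [cost, hg, Ω] using h
    · simp only [cost, hg, if_false, neg_zero, Real.exp_zero, one_mul]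
      exact_mod_cast Finset.card_le_univ _
  have hcost : ∀ A ∈ F, (k : ℝ) ^ d ≤ ∑ v, cost A v := by
    intro A hA
    have hA := (Finset.mem_filter.1 hA).2
    have hmain := le_sum_card_children_large (d := d) (by omega : 0 < k) (by omega : 0 < q) (α A)
      (fun h u _ => by positivity)
      (fun h u hh => by
        rw [div_le_one (by positivity)]
        exact_mod_cast extensionCount_le A hh u)
      (fun h u hh => by
        have hs : (∑ c, (extensionCount A (h + 1) (Fin.snoc u c) : ℝ)) = extensionCount A h u := by
          exact_mod_cast sum_extensionCount_snoc A hh u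
        have hpow : (k : ℝ) ^ (d - h) = k * k ^ (d - (h + 1)) := by
          rw [← pow_succ']
          congr 1
          omega
        simp only [α]
        rw [← Finset.sum_div, hs, hpow]
        field_simp)
      (fun u => by
        have hroot : extensionCount A 0 u = A.card := by simp [extensionCount]
        simp only [α, hroot, Nat.sub_zero]
        rw [le_div_iff₀ (by positivity), one_div_mul_eq_div]
        exact hA)
    have hsum : ∑ v, cost A v = (k : ℝ) ^ d / (k * (2 * (4 * q)) ^ (k + 1)) *
        ∑ h ∈ Finset.range d, ((Finset.univ.filter fun u : Fin h → Fin k =>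
          ∀ c, 1 / (4 * q : ℝ) ≤ α A (h + 1) (Fin.snoc u c)).card : ℝ) / (k : ℝ) ^ h := by
      rw [Fintype.sum_sigma, Finset.sum_range, Finset.mul_sum]
      refine Finset.sum_congr rfl fun h _ => ?_
      have hpow : (k : ℝ) ^ d = k ^ (d - ((h : ℕ) + 1)) * k ^ (h : ℕ) * k := by
        rw [mul_assoc, ← pow_succ, ← pow_add]
        congr 1
        omega
      simp only [cost, good]
      rw [← Finset.sum_filter, Finset.sum_const, nsmul_eq_mul, hpow]
      field_simp
    rw [hsum]
    have h8 : (8 : ℝ) ≤ 4 * q := by linarith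
    have hpow3 : (k : ℝ) * (4 * q) ^ 3 ≤ d := le_trans (by
      gcongr
      · linarith
      · omega) hdk
    have hpowk : (k : ℝ) * (4 * q) ^ (2 * (k + 1) + 1) ≤ d := le_trans (by
      gcongr
      · linarith
      · omega) hdk
    have hbase : (2 * (4 * q : ℝ)) ^ (k + 1) ≤ (4 * q) ^ (2 * (k + 1)) := by
      rw [pow_mul]
      gcongr
      nlinarith
    have hd4 : (d : ℝ) / (4 * q) ≤ d / (2 * q) - 16 * k * q ^ 2 := by
      have h1 : (d : ℝ) / (2 * q) = d / (4 * q) + d / (4 * q) := by field_simp; ring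
      have h2 : 16 * (k : ℝ) * q ^ 2 ≤ d / (4 * q) := by
        rw [le_div_iff₀ (by positivity)]
        linarith
      linarith
    calc (k : ℝ) ^ d = (k : ℝ) ^ d / (k * (2 * (4 * q)) ^ (k + 1)) *
          (k * (2 * (4 * q)) ^ (k + 1)) := by field_simp
      _ ≤ _ := by
        gcongr
        refine le_trans ?_ (hd4.trans hmain)
        rw [le_div_iff₀ (by positivity)]
        refine le_trans ?_ hpowk
        calc (k : ℝ) * (2 * (4 * q)) ^ (k + 1) * (4 * q) ≤
              k * (4 * q) ^ (2 * (k + 1)) * (4 * q) := by gcongr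
          _ = k * (4 * q) ^ (2 * (k + 1) + 1) := by ring
  have hunion : ∑ A ∈ F, ∏ v, Real.exp (-cost A v) < 1 := by
    have hcard : (F.card : ℝ) ≤ 2 ^ (k ^ d) := by
      have := Finset.card_le_univ F
      rw [Fintype.card_finset, Fintype.card_pi_const, Fintype.card_fin] at this
      exact_mod_cast this
    calc ∑ A ∈ F, ∏ v, Real.exp (-cost A v) ≤ F.card * Real.exp (-(k : ℝ) ^ d) := by
          rw [← nsmul_eq_mul]
          refine Finset.sum_le_card_nsmul _ _ _ fun A hA => ?_
          rw [← Real.exp_sum, Finset.sum_neg_distrib]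
          exact Real.exp_le_exp.2 (neg_le_neg (hcost A hA))
      _ ≤ 2 ^ (k ^ d) * Real.exp (-(k : ℝ) ^ d) := by gcongr
      _ < 1 := by
          have hexp : Real.exp ((k : ℝ) ^ d) = Real.exp 1 ^ (k ^ d) := by
            rw [← Real.exp_nat_mul]
            simp
          rw [Real.exp_neg, ← div_eq_mul_inv, div_lt_one (Real.exp_pos _), hexp]
          have : (2 : ℝ) < Real.exp 1 := by linarith [Real.exp_one_gt_d9]
          exact pow_lt_pow_left₀ this (by norm_num) (by positivity)
  obtain ⟨ω, hω⟩ := exists_pi_forall_exists_notMem (Ω := Ω) F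
    (fun A v => avoidingPerms (B A v)) (fun A v => Real.exp (-cost A v)) hbad hunion
  have hinj : Function.Injective fun i : V × Fin k => child (vtx i.1) (hvtx i.1) i.2 := by
    rintro ⟨⟨⟨h, hh⟩, u⟩, c⟩ ⟨⟨⟨h', hh'⟩, u'⟩, c'⟩ heq
    simp only [child, vtx, Sigma.mk.injEq, Fin.mk.injEq] at heq
    obtain ⟨h1, h2⟩ := heq
    obtain rfl : h = h' := by simpa using h1
    have h3 := Fin.snoc_inj.1 (eq_of_heq h2)
    obtain ⟨rfl, rfl⟩ := h3
    rfl
  have : ∀ v : Vtx k d, Nonempty ({w // w ∈ subLeaves v} ≃ Fin (k ^ (d - (v.1 : ℕ)))) :=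
    nonempty_subLeaves_equiv
  obtain ⟨β, hβ⟩ := exists_forall_apply_eq_of_injective hinj
    (F := fun v : Vtx k d => {w // w ∈ subLeaves v} ≃ Fin (k ^ (d - (v.1 : ℕ))))
    (fun i => (e (child (vtx i.1) (hvtx i.1) i.2)).trans (ω i.1 i.2).symm)
  refine ⟨β, fun A hA => ?_⟩
  obtain ⟨v, hv⟩ := hω A (Finset.mem_filter.2 ⟨Finset.mem_univ _, hA⟩)
  have hx : ∃ x, ∀ c, ω v c x ∈ B A v c := by simpa [avoidingPerms] using hv
  obtain ⟨x, hx⟩ := hx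
  refine ⟨vtx v, hvtx v, x, fun c => ?_⟩
  refine ⟨((e (child (vtx v) (hvtx v) c)).symm (ω v c x)).1, Subtype.prop _,
    (Finset.mem_filter.1 (hx c)).2, ?_⟩
  have hβc : β (child (vtx v) (hvtx v) c) =
    (e (child (vtx v) (hvtx v) c)).trans (ω v c).symm := hβ (v, c)
  rw [hβc]
  simp
end
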